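/- Let κ > 0, and a : [k₁,k₂] → ℂ continuous with 0 < k₁ < k₂. Define the positive-frequency Dirac packet U[a](x⁰,x¹) = ∫_{k₁}^{k₂} a(k) U_k(x⁰,x¹) dk/(2ω̄(k)) with U_k as before. Let v₁ < k₁/ω̄(k₁) and v₂ > k₂/ω̄(k₂). Then lim_{τ→±∞} ∫_{τ·[v₁,v₂]} (|U[a]¹(τ,x)|² + |U[a]²(τ,x)|²) dx = ‖U[a]_0‖², i.e. the probability density asymptotically localizes in the interval τ·[v₁,v₂]. In particular for τ → -∞ the packet is localized in x¹ < 0 and for τ → +∞ in x¹ > 0. -/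

import Mathlib

open Real MeasureTheory Filter

noncomputable def ob (κ k : ℝ) : ℝ := Real.sqrt (κ^2 + k^2)
noncomputable def Om (κ k : ℝ) : ℝ := Real.sqrt (ob κ k + k)

/-- First component of the positive frequency packet U[a]. -/
noncomputable def Ua1 (κ k1 k2 : ℝ) (a : ℝ → ℂ) (τ x : ℝ) : ℂ :=
  ∫ k in k1..k2, a k * (Real.sqrt (2*π))⁻¹ *
    Complex.exp (-Complex.I * ((ob κ k) * τ - k * x)) * (Om κ k : ℂ) / (2 * ob κ k)

/-- Second component of the positive frequency packet U[a]. -/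
noncomputable def Ua2 (κ k1 k2 : ℝ) (a : ℝ → ℂ) (τ x : ℝ) : ℂ :=
  ∫ k in k1..k2, a k * (Real.sqrt (2*π))⁻¹ *
    Complex.exp (-Complex.I * ((ob κ k) * τ - k * x)) * (Om κ (-k) : ℂ) / (2 * ob κ k)

open scoped FourierTransform SchwartzMap ContDiff in
/-- **Plancherel's theorem** for the Fourier integral of a function in `L¹ ∩ L²`. -/
theorem memLp_fourier_and_integral_norm_sq_fourier {h : ℝ → ℂ} (h1 : Integrable h)
    (h2 : MemLp h 2) :
    MemLp (𝓕 h) 2 ∧ ∫ x, ‖𝓕 h x‖ ^ 2 = ∫ x, ‖h x‖ ^ 2 := by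
  have hcont : Continuous (𝓕 h) :=
    VectorFourier.fourierIntegral_continuous Real.continuous_fourierChar
      (by exact continuous_inner) h1
  set H : Lp ℂ 2 (volume : Measure ℝ) := h2.toLp h with hH
  have hae : ((𝓕 H : Lp ℂ 2 (volume : Measure ℝ)) : ℝ → ℂ) =ᵐ[volume] 𝓕 h := by
    refine ae_eq_of_integral_contDiff_smul_eq
      ((Lp.memLp (𝓕 H)).locallyIntegrable (by norm_num)) hcont.locallyIntegrable ?_
    intro g hg hgs
    have hgs' : HasCompactSupport (fun x => (g x : ℂ)) :=
      hgs.comp_left (g := fun y : ℝ => (y : ℂ)) (by simp)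
    let G : 𝓢(ℝ, ℂ) := hgs'.toSchwartzMap (Complex.ofRealCLM.contDiff.comp hg)
    have key := congrArg (fun T => T G) (Lp.fourier_toTemperedDistribution_eq H)
    simp only [TemperedDistribution.fourier_apply, Lp.toTemperedDistribution_apply] at key
    have e1 : ∫ x, (𝓕 G) x • H x = ∫ x, (𝓕 G) x • h x := by
      refine integral_congr_ae ?_
      filter_upwards [h2.coeFn_toLp] with x hx
      rw [hH, hx]
    have e2 : ∫ x, (𝓕 G) x • h x = ∫ x, G x • 𝓕 h x := by
      simpa using! (VectorFourier.integral_fourierIntegral_smul_eq_flip (L := innerₗ ℝ)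
        Real.continuous_fourierChar continuous_inner G.integrable h1)
    rw [e1, e2] at key
    have hG : ∀ x, G x = (g x : ℂ) := fun x => rfl
    simp only [hG] at key
    simpa using key.symm
  have hmem : MemLp (𝓕 h) 2 := (memLp_congr_ae hae).1 (Lp.memLp _)
  have hsq : ∀ F : Lp ℂ 2 (volume : Measure ℝ), ∫ x, ‖F x‖ ^ 2 = ‖F‖ ^ 2 := by
    intro F
    have := L2.inner_def (𝕜 := ℂ) F F
    rw [inner_self_eq_norm_sq_to_K] at this
    simp only [inner_self_eq_norm_sq_to_K] at this
    apply Complex.ofReal_injective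
    rw [← integral_complex_ofReal]
    push_cast
    exact this.symm
  refine ⟨hmem, ?_⟩
  calc ∫ x, ‖𝓕 h x‖ ^ 2 = ∫ x, ‖(𝓕 H : Lp ℂ 2 (volume : Measure ℝ)) x‖ ^ 2 :=
        integral_congr_ae (by filter_upwards [hae] with x hx; rw [hx])
    _ = ∫ x, ‖H x‖ ^ 2 := by rw [hsq, hsq, Lp.norm_fourier_eq]
    _ = ∫ x, ‖h x‖ ^ 2 :=
        integral_congr_ae (by filter_upwards [h2.coeFn_toLp] with x hx; rw [hH, hx])

/-- The wave packet with amplitude `f` on `[k₁, k₂]` and dispersion relation `ω`. -/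
noncomputable def wavePacket (ω : ℝ → ℝ) (k₁ k₂ : ℝ) (f : ℝ → ℂ) (τ x : ℝ) : ℂ :=
  ∫ k in k₁..k₂, f k * Complex.exp (((k * x - ω k * τ : ℝ) : ℂ) * Complex.I)

section WavePacket

variable {ω : ℝ → ℝ} {k₁ k₂ : ℝ} {f g : ℝ → ℂ}

open scoped FourierTransform in
/-- The spatial `L²` norm of a wave packet is finite and conserved. -/
theorem wavePacket_plancherel (hω : Continuous ω) (hk : k₁ ≤ k₂)
    (hf : ContinuousOn f (Set.Icc k₁ k₂)) (τ : ℝ) :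
    MemLp (wavePacket ω k₁ k₂ f τ) 2 ∧
      ∫ x, ‖wavePacket ω k₁ k₂ f τ x‖ ^ 2 = 2 * π * ∫ k in k₁..k₂, ‖f k‖ ^ 2 := by
  set φ : ℝ → ℂ := fun k => f k * Complex.exp (((-(ω k * τ) : ℝ) : ℂ) * Complex.I) with hφ
  have hφc : ContinuousOn φ (Set.Icc k₁ k₂) := hf.mul (by fun_prop)
  have hφn : ∀ k, ‖φ k‖ = ‖f k‖ := fun k => by
    rw [hφ, norm_mul, Complex.norm_exp_ofReal_mul_I, mul_one]
  set h : ℝ → ℂ := (Set.Icc k₁ k₂).indicator φ with hh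
  have h1 : Integrable h := (integrable_indicator_iff measurableSet_Icc).2
    (hφc.integrableOn_compact isCompact_Icc)
  have h2 : MemLp h 2 := by
    obtain ⟨C, hC⟩ := isCompact_Icc.exists_bound_of_continuousOn hφc
    rw [hh, memLp_indicator_iff_restrict measurableSet_Icc]
    have : IsFiniteMeasure (volume.restrict (Set.Icc k₁ k₂)) := by
      constructor; simp
    refine MemLp.of_bound (hφc.aestronglyMeasurable measurableSet_Icc) C ?_
    exact (ae_restrict_iff' measurableSet_Icc).2 (Eventually.of_forall hC)
  have hW : wavePacket ω k₁ k₂ f τ = fun x => 𝓕 h ((-(2 * π)⁻¹) * x) := by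
    ext x
    rw [Real.fourier_eq', wavePacket, intervalIntegral.integral_of_le hk,
      ← integral_Icc_eq_integral_Ioc, ← integral_indicator measurableSet_Icc]
    refine integral_congr_ae (Eventually.of_forall fun k => ?_)
    by_cases hkm : k ∈ Set.Icc k₁ k₂
    · simp only [hh, Set.indicator_of_mem hkm, hφ, smul_eq_mul]
      rw [mul_left_comm, ← Complex.exp_add]
      congr 2
      simp only [RCLike.inner_apply, conj_trivial]
      have : (2 * π) ≠ 0 := by positivity
      rw [← add_mul, ← Complex.ofReal_add]
      congr 2
      field_simp
      ring
    · simp [hh, Set.indicator_of_notMem hkm]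
  obtain ⟨p1, p2⟩ := memLp_fourier_and_integral_norm_sq_fourier h1 h2
  have hc : (-(2 * π)⁻¹ : ℝ) ≠ 0 := by simp [pi_ne_zero]
  rw [hW]
  constructor
  · rw [memLp_two_iff_integrable_sq_norm]
    · have := (memLp_two_iff_integrable_sq_norm p1.1).1 p1
      exact this.comp_mul_left' hc
    · exact p1.1.comp_quasiMeasurePreserving
        (Measure.quasiMeasurePreserving_smul (volume : Measure ℝ) hc)
  · rw [Measure.integral_comp_mul_left (fun y => ‖𝓕 h y‖ ^ 2), p2,
      intervalIntegral.integral_of_le hk, ← integral_Icc_eq_integral_Ioc,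
      ← integral_indicator measurableSet_Icc]
    have : |(-(2 * π)⁻¹ : ℝ)⁻¹| = 2 * π := by
      rw [inv_neg, abs_neg, inv_inv, abs_of_pos (by positivity)]
    rw [this, smul_eq_mul]
    congr 2
    ext k
    by_cases hkm : k ∈ Set.Icc k₁ k₂ <;> simp [hh, hkm, hφn]

theorem wavePacket_sub (hω : Continuous ω) (hk : k₁ ≤ k₂) (hf : ContinuousOn f (Set.Icc k₁ k₂))
    (hg : ContinuousOn g (Set.Icc k₁ k₂)) (τ x : ℝ) :
    wavePacket ω k₁ k₂ (fun k => f k - g k) τ x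
      = wavePacket ω k₁ k₂ f τ x - wavePacket ω k₁ k₂ g τ x := by
  have hinteg : ∀ {q : ℝ → ℂ}, ContinuousOn q (Set.Icc k₁ k₂) → IntervalIntegrable
      (fun k => q k * Complex.exp (((k * x - ω k * τ : ℝ) : ℂ) * Complex.I)) volume k₁ k₂ := by
    intro q hq
    refine ContinuousOn.intervalIntegrable ?_
    rw [Set.uIcc_of_le hk]
    exact hq.mul (by fun_prop)
  simp only [wavePacket, sub_mul]
  exact intervalIntegral.integral_sub (hinteg hf) (hinteg hg)

/-- Non-stationary phase estimate obtained from one integration by parts. -/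
theorem norm_wavePacket_le_of_le_abs_phase_deriv (hω : ContDiff ℝ 2 ω) (hk : k₁ ≤ k₂)
    (hg : ContDiff ℝ 1 g) {M M' B : ℝ} (hM : ∀ k ∈ Set.Icc k₁ k₂, ‖g k‖ ≤ M)
    (hM' : ∀ k ∈ Set.Icc k₁ k₂, ‖deriv g k‖ ≤ M')
    (hB : ∀ k ∈ Set.Icc k₁ k₂, |deriv (deriv ω) k| ≤ B) {τ x m : ℝ} (hm : 0 < m)
    (hp : ∀ k ∈ Set.Icc k₁ k₂, m ≤ |x - deriv ω k * τ|) :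
    ‖wavePacket ω k₁ k₂ g τ x‖ ≤
      (2 * M + (M' + M * B * (|τ| / m)) * (k₂ - k₁)) / m := by
  have hω' : ContDiff ℝ 1 (deriv ω) := ((contDiff_succ_iff_deriv (n := 1)).1 hω).2.2
  have hωd : ∀ k, HasDerivAt ω (deriv ω k) k := fun k =>
    (hω.differentiable (by norm_num) k).hasDerivAt
  have hωdd : ∀ k, HasDerivAt (deriv ω) (deriv (deriv ω) k) k := fun k =>
    (hω'.differentiable (by norm_num) k).hasDerivAt
  have hω'c : Continuous (deriv ω) := hω'.continuous
  have hω''c : Continuous (deriv (deriv ω)) := hω'.continuous_deriv (by norm_num)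
  have hgd : ∀ k, HasDerivAt g (deriv g k) k := fun k =>
    (hg.differentiable (by norm_num) k).hasDerivAt
  have hgc : Continuous g := hg.continuous
  have hg'c : Continuous (deriv g) := hg.continuous_deriv (by norm_num)
  have hωc : Continuous ω := hω.continuous
  have hI : Set.uIcc k₁ k₂ = Set.Icc k₁ k₂ := Set.uIcc_of_le hk
  set p : ℝ → ℂ := fun k => ((x - deriv ω k * τ : ℝ) : ℂ) * Complex.I with hpdef
  have hpn : ∀ k, ‖p k‖ = |x - deriv ω k * τ| := fun k => by
    rw [hpdef, norm_mul, Complex.norm_real, Complex.norm_I, mul_one, Real.norm_eq_abs]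
  have hp0 : ∀ k ∈ Set.Icc k₁ k₂, p k ≠ 0 := fun k hkm => by
    rw [← norm_pos_iff, hpn]; exact hm.trans_le (hp k hkm)
  have hpd : ∀ k, HasDerivAt p (((-(deriv (deriv ω) k * τ) : ℝ) : ℂ) * Complex.I) k := fun k =>
    (((hωdd k).mul_const τ).const_sub x).ofReal_comp.mul_const Complex.I
  have hpc : Continuous p := by fun_prop
  set e : ℝ → ℂ := fun k => Complex.exp (((k * x - ω k * τ : ℝ) : ℂ) * Complex.I) with hedef
  have hen : ∀ k, ‖e k‖ = 1 := fun k => Complex.norm_exp_ofReal_mul_I _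
  have hed : ∀ k, HasDerivAt e (p k * e k) k := fun k => by
    have h1 : HasDerivAt (fun k : ℝ => k * x - ω k * τ) (x - deriv ω k * τ) k := by
      simpa using! ((hasDerivAt_id k).mul_const x).sub ((hωd k).mul_const τ)
    have := (h1.ofReal_comp.mul_const Complex.I).cexp
    rw [mul_comm (p k)]
    exact this
  have hec : Continuous e := by fun_prop
  set u' : ℝ → ℂ := fun k =>
    (deriv g k * p k - g k * (((-(deriv (deriv ω) k * τ) : ℝ) : ℂ) * Complex.I)) / p k ^ 2
    with hu'def
  have hud : ∀ k ∈ Set.Icc k₁ k₂, HasDerivAt (fun k => g k / p k) (u' k) k := fun k hkm =>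
    (hgd k).div (hpd k) (hp0 k hkm)
  have hu'c : ContinuousOn u' (Set.Icc k₁ k₂) :=
    ContinuousOn.div (by fun_prop) (by fun_prop) fun k hkm => pow_ne_zero 2 (hp0 k hkm)
  have hparts := intervalIntegral.integral_mul_deriv_eq_deriv_mul (a := k₁) (b := k₂)
    (u := fun k => g k / p k) (u' := u') (v := e) (v' := fun k => p k * e k)
    (fun k hkm => hud k (hI ▸ hkm)) (fun k _ => hed k)
    (by apply ContinuousOn.intervalIntegrable; rwa [hI])
    ((hpc.mul hec).intervalIntegrable _ _)
  have hW : wavePacket ω k₁ k₂ g τ x = ∫ k in k₁..k₂, g k / p k * (p k * e k) := by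
    refine intervalIntegral.integral_congr fun k hkm => ?_
    have := hp0 k (hI ▸ hkm)
    change g k * e k = _
    field_simp
  have hend : ∀ k ∈ Set.Icc k₁ k₂, ‖g k / p k * e k‖ ≤ M / m := fun k hkm => by
    rw [norm_mul, hen, mul_one, norm_div, hpn]
    exact div_le_div₀ ((norm_nonneg _).trans (hM k hkm)) (hM k hkm) hm (hp k hkm)
  have hu'n : ∀ k ∈ Set.Icc k₁ k₂, ‖u' k * e k‖ ≤ M' / m + M * (B * |τ|) / m ^ 2 := by
    intro k hkm
    have hpk := hp0 k hkm
    have hM0 := (norm_nonneg _).trans (hM k hkm)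
    have hM'0 := (norm_nonneg _).trans (hM' k hkm)
    have hB0 := (abs_nonneg _).trans (hB k hkm)
    have hsplit : u' k = deriv g k / p k
        - g k * (((-(deriv (deriv ω) k * τ) : ℝ) : ℂ) * Complex.I) / p k ^ 2 := by
      simp only [hu'def]
      field_simp
    rw [norm_mul, hen, mul_one, hsplit]
    refine (norm_sub_le _ _).trans (add_le_add ?_ ?_)
    · rw [norm_div, hpn]
      exact div_le_div₀ hM'0 (hM' k hkm) hm (hp k hkm)
    · rw [norm_div, norm_pow, hpn, norm_mul, norm_mul, Complex.norm_I, mul_one, Complex.norm_real,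
        norm_neg, norm_mul, Real.norm_eq_abs, Real.norm_eq_abs]
      have := hB k hkm
      have := hM k hkm
      have := hp k hkm
      gcongr
  have hinteg := intervalIntegral.norm_integral_le_of_norm_le_const (a := k₁) (b := k₂)
    (f := fun k => u' k * e k) (C := M' / m + M * (B * |τ|) / m ^ 2)
    (fun k hkm => hu'n k (hI ▸ Set.uIoc_subset_uIcc hkm))
  rw [abs_of_nonneg (sub_nonneg.2 hk)] at hinteg
  rw [hW, hparts]
  have h1 := hend k₁ (Set.left_mem_Icc.2 hk)
  have h2 := hend k₂ (Set.right_mem_Icc.2 hk)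
  calc _ ≤ M / m + M / m + (M' / m + M * (B * |τ|) / m ^ 2) * (k₂ - k₁) :=
        (norm_sub_le _ _).trans (add_le_add ((norm_sub_le _ _).trans (add_le_add h2 h1)) hinteg)
    _ = _ := by field_simp; ring

/-- Away from the cone swept out by the group velocities, a packet with `C¹` amplitude decays. -/
theorem exists_norm_sq_wavePacket_le (hω : ContDiff ℝ 2 ω) (hk : k₁ ≤ k₂)
    (hg : ContDiff ℝ 1 g) {v₁ v₂ u₁ u₂ : ℝ} (hv₁ : v₁ < u₁) (hv₂ : u₂ < v₂)
    (hu : ∀ k ∈ Set.Icc k₁ k₂, deriv ω k ∈ Set.Icc u₁ u₂) :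
    ∃ C : ℝ, ∀ τ x : ℝ, 0 < τ → x ∉ Set.uIcc (τ * v₁) (τ * v₂) →
      ‖wavePacket ω k₁ k₂ g τ x‖ ^ 2 ≤ C / (τ ^ 2 + x ^ 2) := by
  have hω' : ContDiff ℝ 1 (deriv ω) := ((contDiff_succ_iff_deriv (n := 1)).1 hω).2.2
  obtain ⟨M, hM⟩ := isCompact_Icc.exists_bound_of_continuousOn
    (hg.continuous.continuousOn (s := Set.Icc k₁ k₂))
  obtain ⟨M', hM'⟩ := isCompact_Icc.exists_bound_of_continuousOn
    ((hg.continuous_deriv (by norm_num)).continuousOn (s := Set.Icc k₁ k₂))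
  obtain ⟨B, hB⟩ := isCompact_Icc.exists_bound_of_continuousOn
    ((hω'.continuous_deriv (by norm_num)).continuousOn (s := Set.Icc k₁ k₂))
  obtain ⟨A, hA⟩ := isCompact_Icc.exists_bound_of_continuousOn
    (hω'.continuous.continuousOn (s := Set.Icc k₁ k₂))
  have hkm := Set.left_mem_Icc.2 hk
  have hM0 := (norm_nonneg _).trans (hM k₁ hkm)
  have hM'0 := (norm_nonneg _).trans (hM' k₁ hkm)
  have hB0 := (norm_nonneg _).trans (hB k₁ hkm)
  have hA0 := (norm_nonneg _).trans (hA k₁ hkm)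
  have hu12 := (hu k₁ hkm).1.trans (hu k₁ hkm).2
  have hδ : 0 < min (u₁ - v₁) (v₂ - u₂) := lt_min (sub_pos.2 hv₁) (sub_pos.2 hv₂)
  set δ := min (u₁ - v₁) (v₂ - u₂) with hδdef
  set c := δ / (δ + 1 + A) with hc
  have hc0 : 0 < c := by positivity
  have hL : 0 ≤ k₂ - k₁ := sub_nonneg.2 hk
  refine ⟨((2 * M + (M' + M * B * (1 / c)) * (k₂ - k₁)) / c) ^ 2, fun τ x hτ hx => ?_⟩
  have hdist : ∀ k ∈ Set.Icc k₁ k₂, δ * τ ≤ |x - deriv ω k * τ| := by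
    intro k hkm
    obtain ⟨h1, h2⟩ := hu k hkm
    have hd1 : δ ≤ u₁ - v₁ := min_le_left _ _
    have hd2 : δ ≤ v₂ - u₂ := min_le_right _ _
    have hle : τ * v₁ ≤ τ * v₂ := by
      have : v₁ ≤ v₂ := by linarith
      gcongr
    rw [Set.uIcc_of_le hle, Set.mem_Icc, not_and_or, not_le, not_le] at hx
    rcases hx with hx | hx
    · have := mul_le_mul_of_nonneg_right (show δ + v₁ ≤ deriv ω k by linarith) hτ.le
      rw [abs_sub_comm]
      exact le_trans (by linarith) (le_abs_self _)
    · have := mul_le_mul_of_nonneg_right (show δ + deriv ω k ≤ v₂ by linarith) hτ.le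
      exact le_trans (by linarith) (le_abs_self _)
  have hp : ∀ k ∈ Set.Icc k₁ k₂, c * (τ + |x|) ≤ |x - deriv ω k * τ| := by
    intro k hkm
    have h1 := hdist k hkm
    have h2 : |x| ≤ |x - deriv ω k * τ| + A * τ := by
      have h3 := abs_add_le (x - deriv ω k * τ) (deriv ω k * τ)
      rw [sub_add_cancel, abs_mul, abs_of_pos hτ] at h3
      have h4 : |deriv ω k| * τ ≤ A * τ := mul_le_mul_of_nonneg_right (hA k hkm) hτ.le
      linarith
    rw [hc, div_mul_eq_mul_div, div_le_iff₀ (by positivity)]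
    have h5 := mul_le_mul_of_nonneg_left h1 (show 0 ≤ 1 + A by positivity)
    have h6 := mul_le_mul_of_nonneg_left h2 hδ.le
    nlinarith
  have hs : 0 < τ + |x| := by positivity
  have hmain := norm_wavePacket_le_of_le_abs_phase_deriv hω hk hg hM hM' hB
    (m := c * (τ + |x|)) (by positivity) hp
  have hratio : |τ| / (c * (τ + |x|)) ≤ 1 / c := by
    rw [abs_of_pos hτ, div_le_div_iff₀ (by positivity) hc0]
    nlinarith [abs_nonneg x]
  have hbound : ‖wavePacket ω k₁ k₂ g τ x‖ ≤
      (2 * M + (M' + M * B * (1 / c)) * (k₂ - k₁)) / c / (τ + |x|) := by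
    rw [div_div]
    refine hmain.trans ?_
    gcongr
  calc ‖wavePacket ω k₁ k₂ g τ x‖ ^ 2 ≤
        ((2 * M + (M' + M * B * (1 / c)) * (k₂ - k₁)) / c / (τ + |x|)) ^ 2 := by gcongr
    _ = ((2 * M + (M' + M * B * (1 / c)) * (k₂ - k₁)) / c) ^ 2 / (τ + |x|) ^ 2 := div_pow _ _ _
    _ ≤ _ := by
      gcongr
      nlinarith [abs_nonneg x, sq_abs x]

/-- Outside the cone swept out by the group velocities, the `L²` mass of a packet with `C¹`
amplitude tends to zero. -/
theorem tendsto_setIntegral_compl_wavePacket_of_contDiff (hω : ContDiff ℝ 2 ω) (hk : k₁ ≤ k₂)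
    (hg : ContDiff ℝ 1 g) {v₁ v₂ u₁ u₂ : ℝ} (hv₁ : v₁ < u₁) (hv₂ : u₂ < v₂)
    (hu : ∀ k ∈ Set.Icc k₁ k₂, deriv ω k ∈ Set.Icc u₁ u₂) :
    Tendsto (fun τ => ∫ x in (Set.uIcc (τ * v₁) (τ * v₂))ᶜ, ‖wavePacket ω k₁ k₂ g τ x‖ ^ 2)
      atTop (nhds 0) := by
  obtain ⟨C, hC⟩ := exists_norm_sq_wavePacket_le hω hk hg hv₁ hv₂ hu
  have hmeas : ∀ τ : ℝ, MeasurableSet (Set.uIcc (τ * v₁) (τ * v₂))ᶜ := fun τ =>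
    measurableSet_uIcc.compl
  have hsq : ∀ τ, Integrable (fun x => ‖wavePacket ω k₁ k₂ g τ x‖ ^ 2) := fun τ =>
    have h := (wavePacket_plancherel hω.continuous hk hg.continuous.continuousOn τ).1
    (memLp_two_iff_integrable_sq_norm h.1).1 h
  have hpt : ∀ τ x : ℝ, 0 < τ → ‖(Set.uIcc (τ * v₁) (τ * v₂))ᶜ.indicator
      (fun x => ‖wavePacket ω k₁ k₂ g τ x‖ ^ 2) x‖ ≤ |C| / (τ ^ 2 + x ^ 2) := by
    intro τ x hτ
    by_cases hx : x ∈ (Set.uIcc (τ * v₁) (τ * v₂))ᶜ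
    · rw [Set.indicator_of_mem hx, Real.norm_of_nonneg (by positivity)]
      refine (hC τ x hτ hx).trans ?_
      gcongr
      exact le_abs_self C
    · rw [Set.indicator_of_notMem hx, norm_zero]
      positivity
  simp_rw [← integral_indicator (hmeas _)]
  rw [← integral_zero ℝ ℝ (μ := volume)]
  refine tendsto_integral_filter_of_dominated_convergence (fun x => |C| * (1 + x ^ 2)⁻¹)
    (Eventually.of_forall fun τ => ((hsq τ).indicator (hmeas τ)).1) ?_
    (integrable_inv_one_add_sq.const_mul _) (Eventually.of_forall fun x => ?_)
  · filter_upwards [eventually_ge_atTop 1] with τ hτ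
    refine Eventually.of_forall fun x => (hpt τ x (by linarith)).trans ?_
    rw [div_eq_mul_inv]
    gcongr
    nlinarith
  · refine squeeze_zero_norm' (a := fun τ : ℝ => |C| / (τ ^ 2 + x ^ 2)) ?_ ?_
    · filter_upwards [eventually_gt_atTop 0] with τ hτ using hpt τ x hτ
    · exact (tendsto_atTop_add_const_right _ _ (tendsto_pow_atTop two_ne_zero)).const_div_atTop _

/-- Weierstrass approximation of a complex valued function by smooth functions. -/
theorem exists_contDiff_norm_sub_le (hf : ContinuousOn f (Set.Icc k₁ k₂)) {ε : ℝ} (hε : 0 < ε) :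
    ∃ g : ℝ → ℂ, ContDiff ℝ 1 g ∧ ∀ k ∈ Set.Icc k₁ k₂, ‖f k - g k‖ ≤ ε := by
  obtain ⟨p, hp⟩ := exists_polynomial_near_of_continuousOn k₁ k₂ (fun k => (f k).re)
    (Complex.continuous_re.comp_continuousOn hf) (ε / 2) (half_pos hε)
  obtain ⟨q, hq⟩ := exists_polynomial_near_of_continuousOn k₁ k₂ (fun k => (f k).im)
    (Complex.continuous_im.comp_continuousOn hf) (ε / 2) (half_pos hε)
  refine ⟨fun k => ((p.eval k : ℝ) : ℂ) + ((q.eval k : ℝ) : ℂ) * Complex.I, ?_, fun k hkm => ?_⟩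
  · have hpoly : ∀ r : Polynomial ℝ, ContDiff ℝ 1 fun k => ((r.eval k : ℝ) : ℂ) := fun r =>
      Complex.ofRealCLM.contDiff.comp (by simpa using r.contDiff_aeval (𝕜 := ℝ) 1)
    exact (hpoly p).add ((hpoly q).mul contDiff_const)
  · refine (Complex.norm_le_abs_re_add_abs_im _).trans ?_
    have h1 := hp k hkm
    have h2 := hq k hkm
    rw [abs_sub_comm] at h1 h2
    simp only [Complex.sub_re, Complex.sub_im, Complex.add_re, Complex.add_im, Complex.ofReal_re,
      Complex.ofReal_im, Complex.re_ofReal_mul, Complex.im_ofReal_mul, Complex.I_re, Complex.I_im,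
      mul_zero, mul_one, add_zero, zero_add]
    linarith

/-- Outside the cone swept out by the group velocities, the `L²` mass of a wave packet tends to
zero. -/
theorem tendsto_setIntegral_compl_wavePacket (hω : ContDiff ℝ 2 ω) (hk : k₁ ≤ k₂)
    (hf : ContinuousOn f (Set.Icc k₁ k₂)) {v₁ v₂ u₁ u₂ : ℝ} (hv₁ : v₁ < u₁) (hv₂ : u₂ < v₂)
    (hu : ∀ k ∈ Set.Icc k₁ k₂, deriv ω k ∈ Set.Icc u₁ u₂) :
    Tendsto (fun τ => ∫ x in (Set.uIcc (τ * v₁) (τ * v₂))ᶜ, ‖wavePacket ω k₁ k₂ f τ x‖ ^ 2)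
      atTop (nhds 0) := by
  have hsq : ∀ {q : ℝ → ℂ}, ContinuousOn q (Set.Icc k₁ k₂) → ∀ τ,
      Integrable (fun x => ‖wavePacket ω k₁ k₂ q τ x‖ ^ 2) := fun hq τ =>
    have h := (wavePacket_plancherel hω.continuous hk hq τ).1
    (memLp_two_iff_integrable_sq_norm h.1).1 h
  have hL : 0 ≤ k₂ - k₁ := sub_nonneg.2 hk
  rw [Metric.tendsto_nhds]
  intro ε hε
  set η := √(ε / (8 * π * (k₂ - k₁ + 1))) with hη
  have hη0 : 0 < η := Real.sqrt_pos.2 (by positivity)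
  have hη2 : 4 * π * ((k₂ - k₁) * η ^ 2) ≤ ε / 2 := by
    rw [hη, Real.sq_sqrt (by positivity)]
    have : 4 * π * ((k₂ - k₁) * (ε / (8 * π * (k₂ - k₁ + 1))))
        = ε / 2 * ((k₂ - k₁) / (k₂ - k₁ + 1)) := by
      field_simp
      ring
    rw [this]
    exact mul_le_of_le_one_right (by positivity) ((div_le_one (by positivity)).2 (by linarith))
  obtain ⟨g, hg, hfg⟩ := exists_contDiff_norm_sub_le hf hη0
  have hgc : ContinuousOn g (Set.Icc k₁ k₂) := hg.continuous.continuousOn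
  have hd : ContinuousOn (fun k => f k - g k) (Set.Icc k₁ k₂) := hf.sub hgc
  have hlim := tendsto_setIntegral_compl_wavePacket_of_contDiff hω hk hg hv₁ hv₂ hu
  have hdiff : ∀ τ, ∫ x, ‖wavePacket ω k₁ k₂ (fun k => f k - g k) τ x‖ ^ 2
      ≤ 2 * π * ((k₂ - k₁) * η ^ 2) := by
    intro τ
    rw [(wavePacket_plancherel hω.continuous hk hd τ).2]
    gcongr
    calc ∫ k in k₁..k₂, ‖f k - g k‖ ^ 2 ≤ ∫ _ in k₁..k₂, η ^ 2 := by
          refine intervalIntegral.integral_mono_on hk ?_ (by simp) fun k hkm => ?_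
          · refine ContinuousOn.intervalIntegrable ?_
            rw [Set.uIcc_of_le hk]
            exact hd.norm.pow 2
          · have := hfg k hkm
            gcongr
      _ = (k₂ - k₁) * η ^ 2 := by simp
  filter_upwards [hlim.eventually (gt_mem_nhds (show 0 < ε / 4 by positivity))] with τ hτ
  set S := (Set.uIcc (τ * v₁) (τ * v₂))ᶜ
  have hle : ∫ x in S, ‖wavePacket ω k₁ k₂ f τ x‖ ^ 2 ≤
      2 * (∫ x in S, ‖wavePacket ω k₁ k₂ g τ x‖ ^ 2)
        + 2 * ∫ x in S, ‖wavePacket ω k₁ k₂ (fun k => f k - g k) τ x‖ ^ 2 := by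
    rw [← integral_const_mul, ← integral_const_mul, ← integral_add]
    · refine integral_mono (hsq hf τ).integrableOn
        (((hsq hgc τ).integrableOn.const_mul 2).add
          ((hsq hd τ).integrableOn.const_mul 2)) fun x => ?_
      have hsum : wavePacket ω k₁ k₂ f τ x = wavePacket ω k₁ k₂ g τ x
          + wavePacket ω k₁ k₂ (fun k => f k - g k) τ x := by
        rw [wavePacket_sub hω.continuous hk hf hgc]; ring
      simp only
      rw [hsum]
      have h1 := norm_add_le (wavePacket ω k₁ k₂ g τ x)
        (wavePacket ω k₁ k₂ (fun k => f k - g k) τ x)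
      nlinarith [sq_nonneg (‖wavePacket ω k₁ k₂ g τ x‖
        - ‖wavePacket ω k₁ k₂ (fun k => f k - g k) τ x‖), norm_nonneg (wavePacket ω k₁ k₂ g τ x
          + wavePacket ω k₁ k₂ (fun k => f k - g k) τ x)]
    · exact (hsq hgc τ).integrableOn.const_mul 2
    · exact (hsq hd τ).integrableOn.const_mul 2
  have hset := setIntegral_le_integral (s := S) (hsq hd τ)
    (Eventually.of_forall fun x => by positivity)
  have hnn : 0 ≤ ∫ x in S, ‖wavePacket ω k₁ k₂ f τ x‖ ^ 2 :=
    integral_nonneg fun x => by positivity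
  rw [Real.dist_eq, sub_zero, abs_of_nonneg hnn]
  linarith [hdiff τ]

/-- A wave packet asymptotically localizes in the cone swept out by its group velocities, in the
far future. -/
theorem tendsto_setIntegral_wavePacket_atTop (hω : ContDiff ℝ 2 ω) (hk : k₁ ≤ k₂)
    (hf : ContinuousOn f (Set.Icc k₁ k₂)) {v₁ v₂ u₁ u₂ : ℝ} (hv₁ : v₁ < u₁) (hv₂ : u₂ < v₂)
    (hu : ∀ k ∈ Set.Icc k₁ k₂, deriv ω k ∈ Set.Icc u₁ u₂) :
    Tendsto (fun τ => ∫ x in Set.uIcc (τ * v₁) (τ * v₂), ‖wavePacket ω k₁ k₂ f τ x‖ ^ 2)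
      atTop (nhds (∫ x, ‖wavePacket ω k₁ k₂ f 0 x‖ ^ 2)) := by
  have hlim := (tendsto_setIntegral_compl_wavePacket hω hk hf hv₁ hv₂ hu).const_sub
    (∫ x, ‖wavePacket ω k₁ k₂ f 0 x‖ ^ 2)
  rw [sub_zero] at hlim
  refine hlim.congr fun τ => ?_
  obtain ⟨hmem, hval⟩ := wavePacket_plancherel hω.continuous hk hf τ
  rw [(wavePacket_plancherel hω.continuous hk hf 0).2, ← hval, ← integral_add_compl
    measurableSet_uIcc ((memLp_two_iff_integrable_sq_norm hmem.1).1 hmem), add_sub_cancel_right]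

/-- A wave packet asymptotically localizes in the cone swept out by its group velocities, in the
remote past. -/
theorem tendsto_setIntegral_wavePacket_atBot (hω : ContDiff ℝ 2 ω) (hk : k₁ ≤ k₂)
    (hf : ContinuousOn f (Set.Icc k₁ k₂)) {v₁ v₂ u₁ u₂ : ℝ} (hv₁ : v₁ < u₁) (hv₂ : u₂ < v₂)
    (hu : ∀ k ∈ Set.Icc k₁ k₂, deriv ω k ∈ Set.Icc u₁ u₂) :
    Tendsto (fun τ => ∫ x in Set.uIcc (τ * v₁) (τ * v₂), ‖wavePacket ω k₁ k₂ f τ x‖ ^ 2)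
      atBot (nhds (∫ x, ‖wavePacket ω k₁ k₂ f 0 x‖ ^ 2)) := by
  have hneg : ∀ τ x, wavePacket (fun k => -ω k) k₁ k₂ f (-τ) x = wavePacket ω k₁ k₂ f τ x := by
    intro τ x
    simp only [wavePacket, neg_mul_neg]
  have h := (tendsto_setIntegral_wavePacket_atTop hω.neg hk hf (neg_lt_neg hv₂) (neg_lt_neg hv₁)
    fun k hkm => by
      rw [deriv.fun_neg]
      exact ⟨neg_le_neg (hu k hkm).2, neg_le_neg (hu k hkm).1⟩).comp tendsto_neg_atBot_atTop
  have h0 : ∀ x, wavePacket (fun k => -ω k) k₁ k₂ f 0 x = wavePacket ω k₁ k₂ f 0 x := fun x => by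
    simpa using hneg 0 x
  simp only [h0] at h
  refine h.congr fun τ => ?_
  simp only [Function.comp_apply, hneg, neg_mul_neg, Set.uIcc_comm (τ * v₂)]

end WavePacket

theorem ob_pos {κ : ℝ} (hκ : 0 < κ) (k : ℝ) : 0 < ob κ k := Real.sqrt_pos.2 (by positivity)

theorem contDiff_ob {κ : ℝ} (hκ : 0 < κ) {n : WithTop ℕ∞} : ContDiff ℝ n (ob κ) :=
  ContDiff.sqrt (by fun_prop) fun k => by positivity

theorem deriv_ob {κ : ℝ} (hκ : 0 < κ) (k : ℝ) : deriv (ob κ) k = k / ob κ k := by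
  have h : HasDerivAt (fun k : ℝ => κ ^ 2 + k ^ 2) (2 * k) k := by
    simpa using (hasDerivAt_pow 2 k).const_add (κ ^ 2)
  have h' := (h.sqrt (by positivity)).deriv
  change deriv (ob κ) k = 2 * k / (2 * ob κ k) at h'
  rw [h', mul_div_mul_left _ _ two_ne_zero]

/-- The group velocity is increasing. -/
theorem div_ob_le_div_ob {κ : ℝ} (hκ : 0 < κ) {k l : ℝ} (hk : 0 ≤ k) (hkl : k ≤ l) :
    k / ob κ k ≤ l / ob κ l := by
  rw [div_le_div_iff₀ (ob_pos hκ k) (ob_pos hκ l)]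
  refine le_of_sq_le_sq ?_ (mul_nonneg (hk.trans hkl) (ob_pos hκ k).le)
  rw [mul_pow, mul_pow, ob, ob, Real.sq_sqrt (by positivity), Real.sq_sqrt (by positivity)]
  have : k ^ 2 ≤ l ^ 2 := by gcongr
  nlinarith [mul_le_mul_of_nonneg_right this (sq_nonneg κ)]

/-- The amplitude, with respect to `exp (-i (ω̄(k) x⁰ - k x¹)) dk`, of a spinor component with
weight `s`. -/
noncomputable def spinorAmplitude (κ : ℝ) (a : ℝ → ℂ) (s : ℝ → ℝ) (k : ℝ) : ℂ :=
  a k * (Real.sqrt (2 * π))⁻¹ * (s k : ℂ) / (2 * ob κ k)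

theorem continuousOn_spinorAmplitude {κ : ℝ} (hκ : 0 < κ) {a : ℝ → ℂ} {S : Set ℝ}
    (ha : ContinuousOn a S) {s : ℝ → ℝ} (hs : Continuous s) :
    ContinuousOn (spinorAmplitude κ a s) S := by
  have hob : Continuous (ob κ) := (contDiff_ob hκ (n := 0)).continuous
  refine ContinuousOn.div ((ha.mul continuousOn_const).mul (by fun_prop)) (by fun_prop)
    fun k _ => ?_
  exact_mod_cast (mul_pos two_pos (ob_pos hκ k)).ne'

theorem continuous_Om {κ : ℝ} (hκ : 0 < κ) : Continuous (Om κ) :=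
  ((contDiff_ob hκ (n := 0)).continuous.add continuous_id).sqrt

theorem Ua1_eq_wavePacket (κ k1 k2 : ℝ) (a : ℝ → ℂ) (τ x : ℝ) :
    Ua1 κ k1 k2 a τ x = wavePacket (ob κ) k1 k2 (spinorAmplitude κ a (Om κ)) τ x := by
  refine intervalIntegral.integral_congr fun k _ => ?_
  have : -Complex.I * ((ob κ k) * τ - k * x) = ((k * x - ob κ k * τ : ℝ) : ℂ) * Complex.I := by
    push_cast
    ring
  simp only [this, spinorAmplitude]
  ring

theorem Ua2_eq_wavePacket (κ k1 k2 : ℝ) (a : ℝ → ℂ) (τ x : ℝ) :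
    Ua2 κ k1 k2 a τ x
      = wavePacket (ob κ) k1 k2 (spinorAmplitude κ a (fun k => Om κ (-k))) τ x := by
  refine intervalIntegral.integral_congr fun k _ => ?_
  have : -Complex.I * ((ob κ k) * τ - k * x) = ((k * x - ob κ k * τ : ℝ) : ℂ) * Complex.I := by
    push_cast
    ring
  simp only [this, spinorAmplitude]
  ring

theorem stmt19 (κ k1 k2 v1 v2 : ℝ) (hκ : 0 < κ) (hk1 : 0 < k1) (hk12 : k1 < k2)
    (a : ℝ → ℂ) (ha : ContinuousOn a (Set.Icc k1 k2))
    (hv1 : v1 < k1 / ob κ k1) (hv2 : k2 / ob κ k2 < v2) :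
    Tendsto (fun τ => ∫ x in Set.uIcc (τ*v1) (τ*v2),
        (‖Ua1 κ k1 k2 a τ x‖^2 + ‖Ua2 κ k1 k2 a τ x‖^2)) atTop
      (nhds (∫ x : ℝ, (‖Ua1 κ k1 k2 a 0 x‖^2 + ‖Ua2 κ k1 k2 a 0 x‖^2))) ∧
    Tendsto (fun τ => ∫ x in Set.uIcc (τ*v1) (τ*v2),
        (‖Ua1 κ k1 k2 a τ x‖^2 + ‖Ua2 κ k1 k2 a τ x‖^2)) atBot
      (nhds (∫ x : ℝ, (‖Ua1 κ k1 k2 a 0 x‖^2 + ‖Ua2 κ k1 k2 a 0 x‖^2))) := by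
  have hω : ContDiff ℝ 2 (ob κ) := contDiff_ob hκ
  have hu : ∀ k ∈ Set.Icc k1 k2, deriv (ob κ) k ∈ Set.Icc (k1 / ob κ k1) (k2 / ob κ k2) :=
    fun k hk => by
      rw [deriv_ob hκ]
      exact ⟨div_ob_le_div_ob hκ hk1.le hk.1, div_ob_le_div_ob hκ (hk1.le.trans hk.1) hk.2⟩
  have hf₁ : ContinuousOn (spinorAmplitude κ a (Om κ)) (Set.Icc k1 k2) :=
    continuousOn_spinorAmplitude hκ ha (continuous_Om hκ)
  have hf₂ : ContinuousOn (spinorAmplitude κ a fun k => Om κ (-k)) (Set.Icc k1 k2) :=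
    continuousOn_spinorAmplitude hκ ha ((continuous_Om hκ).comp continuous_neg)
  have hinteg : ∀ {f : ℝ → ℂ}, ContinuousOn f (Set.Icc k1 k2) → ∀ τ,
      Integrable (fun x => ‖wavePacket (ob κ) k1 k2 f τ x‖ ^ 2) := fun hf τ =>
    have h := (wavePacket_plancherel hω.continuous hk12.le hf τ).1
    (memLp_two_iff_integrable_sq_norm h.1).1 h
  simp only [Ua1_eq_wavePacket, Ua2_eq_wavePacket]
  rw [integral_add (hinteg hf₁ 0) (hinteg hf₂ 0)]
  simp_rw [integral_add (hinteg hf₁ _).integrableOn (hinteg hf₂ _).integrableOn]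
  exact ⟨(tendsto_setIntegral_wavePacket_atTop hω hk12.le hf₁ hv1 hv2 hu).add
      (tendsto_setIntegral_wavePacket_atTop hω hk12.le hf₂ hv1 hv2 hu),
    (tendsto_setIntegral_wavePacket_atBot hω hk12.le hf₁ hv1 hv2 hu).add
      (tendsto_setIntegral_wavePacket_atBot hω hk12.le hf₂ hv1 hv2 hu)⟩
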